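/- arXiv:2412.00655 — 2 statements merged into one kernel-verified Lean document; each statement's English description precedes it below -/
import Mathlib

section
/- Let (Ω,F,P) be an atomless probability space, n ≥ 3, X a bounded random variable, and (X_1,…,X_n) an allocation of X (i.e., Σ_{i=1}^n X_i = X a.s.) in which at least three components are non-degenerate (not a.s. equal to a constant). Then (X_1,…,X_n) is pairwise counter-monotonic if and only if there exist constants m_1,…,m_n ∈ ℝ and an n-composition (A_1,…,A_n) ∈ Π_n such that X_i = (X − m)·1_{A_i} + m_i for all i ∈ {1,…,n}, where m = Σ_{i=1}^n m_i, and either m ≤ ess-inf X or m ≥ ess-sup X. -/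
open MeasureTheory ProbabilityTheory Set

noncomputable section

variable {Ω : Type*} [MeasurableSpace Ω]

/-- An atomless measure: every set of positive measure has a measurable subset of
strictly smaller positive measure. -/
def Atomless (P : Measure Ω) : Prop :=
  ∀ A : Set Ω, MeasurableSet A → 0 < P A →
    ∃ B, B ⊆ A ∧ MeasurableSet B ∧ 0 < P B ∧ P B < P A

/-- Membership in the class `H` of distortion functions: increasing on `[0,1]`,
`h 0 = 0` and `h 1 = 1`. -/
def MemH (h : ℝ → ℝ) : Prop :=
  MonotoneOn h (Icc 0 1) ∧ h 0 = 0 ∧ h 1 = 1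

/-- Two random variables are counter-monotonic. -/
def CounterMonotone (P : Measure Ω) (X Y : Ω → ℝ) : Prop :=
  ∀ᵐ p ∂(P.prod P), (X p.1 - X p.2) * (Y p.1 - Y p.2) ≤ 0

/-- Two random variables are comonotonic. -/
def Comonotone (P : Measure Ω) (X Y : Ω → ℝ) : Prop :=
  ∀ᵐ p ∂(P.prod P), 0 ≤ (X p.1 - X p.2) * (Y p.1 - Y p.2)

/-- A random vector is pairwise counter-monotonic. -/
def PairwiseCtr (P : Measure Ω) {n : ℕ} (Xs : Fin n → Ω → ℝ) : Prop :=
  ∀ i j, i ≠ j → CounterMonotone P (Xs i) (Xs j)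

/-- A random vector is (pairwise) comonotonic. -/
def PairwiseCom (P : Measure Ω) {n : ℕ} (Xs : Fin n → Ω → ℝ) : Prop :=
  ∀ i j, i ≠ j → Comonotone P (Xs i) (Xs j)

/-- An `n`-composition of `Ω`: pairwise disjoint measurable sets whose union is `Ω`. -/
def IsComposition {n : ℕ} (A : Fin n → Set Ω) : Prop :=
  (∀ i, MeasurableSet (A i)) ∧ (∀ i j, i ≠ j → A i ∩ A j = ∅) ∧ (⋃ i, A i) = univ

/-- A set of vectors is counter-monotonic if, along any two distinct coordinates, any two of its
points are ordered in opposite directions. -/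
def CounterMonotoneSet {ι : Type*} (S : Set (ι → ℝ)) : Prop :=
  ∀ x ∈ S, ∀ y ∈ S, ∀ i j, i ≠ j → (x i - y i) * (x j - y j) ≤ 0

namespace CounterMonotoneSet

variable {ι : Type*} {S : Set (ι → ℝ)}

theorem le_of_lt (hS : CounterMonotoneSet S) {x y : ι → ℝ} (hx : x ∈ S) (hy : y ∈ S) {i j : ι}
    (hij : i ≠ j) (h : x i < y i) : y j ≤ x j := by
  have := hS x hx y hy i j hij
  nlinarith

theorem preimage_neg (hS : CounterMonotoneSet S) : CounterMonotoneSet {x | -x ∈ S} := by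
  intro x hx y hy i j hij
  have := hS (-x) hx (-y) hy i j hij
  simp only [Pi.neg_apply] at this
  linarith

/-- Two points of a counter-monotonic set ordered along `i` and `j`, together with a third point
lying above them along `k`, force all points to exceed a common corner in at most one coordinate. -/
theorem exists_lower_corner (hS : CounterMonotoneSet S) {x y z : ι → ℝ}
    (hx : x ∈ S) (hy : y ∈ S) (hz : z ∈ S) {i j k : ι} (hij : i ≠ j) (hik : i ≠ k) (hjk : j ≠ k)
    (hi : y i < x i) (hj : x j < y j) (hk : x k = y k) (hzk : x k < z k) :
    ∃ m : ι → ℝ, ∀ w ∈ S, (∀ l, m l ≤ w l) ∧ ∀ l l', l ≠ l' → w l = m l ∨ w l' = m l' := by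
  classical
  have hzi : z i ≤ y i := hS.le_of_lt hy hz hik.symm (hk ▸ hzk)
  have hzj : z j ≤ x j := hS.le_of_lt hx hz hjk.symm hzk
  have hxm : ∀ l, l ≠ i → l ≠ k → z l = x l := fun l hli hlk =>
    le_antisymm (hS.le_of_lt hx hz hlk.symm hzk)
      (hS.le_of_lt hz hx hli.symm (hzi.trans_lt hi))
  have hym : ∀ l, l ≠ j → l ≠ k → z l = y l := fun l hlj hlk =>
    le_antisymm (hS.le_of_lt hy hz hlk.symm (hk ▸ hzk))
      (hS.le_of_lt hz hy hlj.symm (hzj.trans_lt hj))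
  obtain ⟨m, hmk, hm⟩ : ∃ m : ι → ℝ, m k = x k ∧ ∀ l, l ≠ k → m l = z l :=
    ⟨Function.update z k (x k), by simp, fun l hl => by simp [hl]⟩
  -- each of the three points exceeds `m` in exactly one coordinate
  have key : ∀ p ∈ ({i, j, k} : Set ι), ∃ v ∈ S, m p < v p ∧ ∀ l, l ≠ p → v l = m l := by
    rintro p (rfl | rfl | rfl)
    · exact ⟨x, hx, by grind, fun l hl => by by_cases l = k <;> grind⟩
    · exact ⟨y, hy, by grind, fun l hl => by by_cases l = k <;> grind⟩
    · exact ⟨z, hz, by grind, by grind⟩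
  have avoid : ∀ l l' : ι, ∃ p ∈ ({i, j, k} : Set ι), p ≠ l ∧ p ≠ l' := by
    intro l l'
    by_cases h1 : i ≠ l ∧ i ≠ l'
    · exact ⟨i, by simp, h1⟩
    by_cases h2 : j ≠ l ∧ j ≠ l'
    · exact ⟨j, by simp, h2⟩
    · exact ⟨k, by simp, by grind⟩
  have hpos : ∀ w ∈ S, ∀ l l', l ≠ l' → m l < w l → w l' ≤ m l' := by
    intro w hw l l' hll h
    obtain ⟨p, hp, hpl, hpl'⟩ := avoid l l'
    obtain ⟨v, hv, -, hvm⟩ := key p hp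
    have := hS.le_of_lt hv hw hll (by rwa [hvm l hpl.symm])
    rwa [hvm l' hpl'.symm] at this
  have hnonneg : ∀ w ∈ S, ∀ l, m l ≤ w l := by
    intro w hw l
    by_contra! h
    have hup : ∀ p ∈ ({i, j, k} : Set ι), p ≠ l → m p < w p := by
      intro p hp hpl
      obtain ⟨v, hv, hvp, hvm⟩ := key p hp
      exact hvp.trans_le (hS.le_of_lt hw hv hpl.symm (by rwa [hvm l hpl.symm]))
    obtain ⟨p, hp, hpl, -⟩ := avoid l l
    obtain ⟨q, hq, hql, hqp⟩ := avoid l p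
    exact absurd (hpos w hw p q hqp.symm (hup p hp hpl)) (hup q hq hql).not_ge
  refine ⟨m, fun w hw => ⟨hnonneg w hw, fun l l' hll => ?_⟩⟩
  rcases (hnonneg w hw l).eq_or_lt with h | h
  · exact Or.inl h.symm
  · exact Or.inr (le_antisymm (hpos w hw l l' hll h) (hnonneg w hw l'))

theorem exists_lt_gt (hS : CounterMonotoneSet S) {p q : ι} (hpq : p ≠ q)
    (hp : ∃ x ∈ S, ∃ y ∈ S, x p ≠ y p) (hq : ∃ x ∈ S, ∃ y ∈ S, x q ≠ y q) :
    ∃ x ∈ S, ∃ y ∈ S, ∃ i j, i ≠ j ∧ y i < x i ∧ x j < y j := by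
  have aux : ∀ x ∈ S, ∀ y ∈ S, x p ≠ y p → x q ≠ y q →
      ∃ x ∈ S, ∃ y ∈ S, ∃ i j, i ≠ j ∧ y i < x i ∧ x j < y j := by
    intro x hx y hy h1 h2
    rcases h1.lt_or_gt with h | h
    · exact ⟨x, hx, y, hy, q, p, hpq.symm,
        lt_of_le_of_ne (hS.le_of_lt hx hy hpq h) h2.symm, h⟩
    · exact ⟨x, hx, y, hy, p, q, hpq, h, lt_of_le_of_ne (hS.le_of_lt hy hx hpq h) h2⟩
  obtain ⟨x, hx, y, hy, hxy⟩ := hp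
  by_cases hxyq : x q = y q
  · obtain ⟨z, hz, hzq⟩ : ∃ z ∈ S, z q ≠ x q := by
      obtain ⟨u, hu, v, hv, huv⟩ := hq
      by_cases h : u q = x q
      · exact ⟨v, hv, fun hv' => huv (h.trans hv'.symm)⟩
      · exact ⟨u, hu, h⟩
    by_cases hzp : z p = x p
    · exact aux z hz y hy (hzp ▸ hxy) (hxyq ▸ hzq)
    · exact aux z hz x hx hzp hzq
  · exact aux x hx y hy hxy hxyq

/-- A counter-monotonic set with three non-constant coordinates consists of points that all exceed,
or are all exceeded by, a common corner in at most one coordinate. -/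
theorem exists_corner (hS : CounterMonotoneSet S) {p q r : ι} (hpq : p ≠ q) (hpr : p ≠ r)
    (hqr : q ≠ r) (hp : ∃ x ∈ S, ∃ y ∈ S, x p ≠ y p) (hq : ∃ x ∈ S, ∃ y ∈ S, x q ≠ y q)
    (hr : ∃ x ∈ S, ∃ y ∈ S, x r ≠ y r) :
    ∃ m : ι → ℝ, (∀ w ∈ S, ∀ l l', l ≠ l' → w l = m l ∨ w l' = m l') ∧
      ((∀ w ∈ S, ∀ l, m l ≤ w l) ∨ ∀ w ∈ S, ∀ l, w l ≤ m l) := by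
  obtain ⟨x, hx, y, hy, i, j, hij, hi, hj⟩ := hS.exists_lt_gt hpq hp hq
  obtain ⟨k, hik, hjk, u, hu, v, hv, huv⟩ :
      ∃ k, i ≠ k ∧ j ≠ k ∧ ∃ x ∈ S, ∃ y ∈ S, x k ≠ y k := by
    by_cases h1 : i ≠ p ∧ j ≠ p
    · exact ⟨p, h1.1, h1.2, hp⟩
    by_cases h2 : i ≠ q ∧ j ≠ q
    · exact ⟨q, h2.1, h2.2, hq⟩
    · exact ⟨r, by grind, by grind, hr⟩
  have hk : x k = y k := le_antisymm (hS.le_of_lt hy hx hik hi) (hS.le_of_lt hx hy hjk hj)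
  obtain ⟨z, hz, hzk⟩ : ∃ z ∈ S, z k ≠ x k := by
    by_cases h : u k = x k
    · exact ⟨v, hv, fun hv' => huv (h.trans hv'.symm)⟩
    · exact ⟨u, hu, h⟩
  rcases hzk.lt_or_gt with h | h
  · obtain ⟨m, hm⟩ := hS.preimage_neg.exists_lower_corner (x := -x) (y := -y) (z := -z)
      (by simpa using hx) (by simpa using hy) (by simpa using hz) hij.symm hjk hik
      (by simpa using hj) (by simpa using hi) (by simpa using hk) (by simpa using h)
    refine ⟨-m, fun w hw l l' hll => ?_, Or.inr fun w hw l => ?_⟩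
    · simpa [neg_eq_iff_eq_neg] using (hm (-w) (by simpa using hw)).2 l l' hll
    · simpa using neg_le_neg ((hm (-w) (by simpa using hw)).1 l)
  · obtain ⟨m, hm⟩ := hS.exists_lower_corner hx hy hz hij hik hjk hi hj hk h
    exact ⟨m, fun w hw => (hm w hw).2, Or.inl fun w hw => (hm w hw).1⟩

end CounterMonotoneSet

/-- The law of a pairwise counter-monotonic random vector has counter-monotonic support. -/
theorem PairwiseCtr.counterMonotoneSet_support {P : Measure Ω} [SFinite P] {n : ℕ}
    {Xs : Fin n → Ω → ℝ} (hXs : ∀ i, Measurable (Xs i)) (h : PairwiseCtr P Xs) :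
    CounterMonotoneSet (P.map fun ω i => Xs i ω).support := by
  have hZ : Measurable fun ω i => Xs i ω := measurable_pi_lambda _ hXs
  intro x hx y hy i j hij
  by_contra! hpos
  have hopen : IsOpen {p : (Fin n → ℝ) × (Fin n → ℝ) |
      0 < (p.1 i - p.2 i) * (p.1 j - p.2 j)} :=
    isOpen_lt continuous_const (by fun_prop)
  obtain ⟨U, V, hU, hV, hxU, hyV, hUV⟩ := isOpen_prod_iff.mp hopen x y hpos
  have hPU := (Measure.mem_support_iff_forall x).mp hx U (hU.mem_nhds hxU)
  have hPV := (Measure.mem_support_iff_forall y).mp hy V (hV.mem_nhds hyV)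
  rw [Measure.map_apply hZ hU.measurableSet] at hPU
  rw [Measure.map_apply hZ hV.measurableSet] at hPV
  have hnull : (P.prod P) (((fun ω i => Xs i ω) ⁻¹' U) ×ˢ ((fun ω i => Xs i ω) ⁻¹' V)) = 0 := by
    refine measure_mono_null (fun p hp => ?_) (ae_iff.mp (h i j hij))
    exact not_le.mpr (hUV (Set.mk_mem_prod hp.1 hp.2))
  rw [Measure.prod_prod] at hnull
  exact (ENNReal.mul_pos hPU.ne' hPV.ne').ne' hnull

theorem ae_mem_support_map {P : Measure Ω} {n : ℕ} {Xs : Fin n → Ω → ℝ}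
    (hXs : ∀ i, Measurable (Xs i)) :
    ∀ᵐ ω ∂P, (fun i => Xs i ω) ∈ (P.map fun ω i => Xs i ω).support :=
  ae_of_ae_map (measurable_pi_lambda _ hXs).aemeasurable Measure.support_mem_ae

theorem exists_ne_mem_support_of_nondegenerate {P : Measure Ω} [NeZero P] {n : ℕ}
    {Xs : Fin n → Ω → ℝ} (hXs : ∀ i, Measurable (Xs i)) {i : Fin n}
    (hi : ¬ ∃ c : ℝ, Xs i =ᵐ[P] fun _ => c) :
    ∃ x ∈ (P.map fun ω i => Xs i ω).support, ∃ y ∈ (P.map fun ω i => Xs i ω).support,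
      x i ≠ y i := by
  by_contra! hconst
  have hmem := ae_mem_support_map (P := P) hXs
  obtain ⟨ω₀, hω₀⟩ := hmem.exists
  exact hi ⟨Xs i ω₀, hmem.mono fun ω hω => hconst _ hω _ hω₀⟩

/-- A vector of random variables almost surely deviating from constants `m` in at most one
component is supported on a composition. -/
theorem exists_composition_of_ae_eq_or_eq {P : Measure Ω} {n : ℕ} (hn : 0 < n) {X : Ω → ℝ}
    {Xs : Fin n → Ω → ℝ} (hXs : ∀ i, Measurable (Xs i)) (hsum : ∀ᵐ ω ∂P, ∑ i, Xs i ω = X ω)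
    {m : Fin n → ℝ} (hm : ∀ᵐ ω ∂P, ∀ i j, i ≠ j → Xs i ω = m i ∨ Xs j ω = m j) :
    ∃ A : Fin n → Set Ω, IsComposition A ∧ ∀ i, Xs i =ᵐ[P] fun ω =>
      (A i).indicator (fun ω' => X ω' - ∑ j, m j) ω + m i := by
  classical
  let i₀ : Fin n := ⟨0, hn⟩
  let B : Fin n → Set Ω := fun i => {ω | Xs i ω ≠ m i ∧ ∀ j, j ≠ i → Xs j ω = m j}
  have hB : ∀ i, MeasurableSet (B i) := fun i => by
    have : B i = {ω | Xs i ω = m i}ᶜ ∩ ⋂ j, ⋂ (_ : j ≠ i), {ω | Xs j ω = m j} := by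
      ext ω; simp [B]
    rw [this]
    exact (measurableSet_eq_fun (hXs i) measurable_const).compl.inter
      (MeasurableSet.iInter fun j => MeasurableSet.iInter fun _ =>
        measurableSet_eq_fun (hXs j) measurable_const)
  have hBB : ∀ i j ω, ω ∈ B i → ω ∈ B j → i = j := by
    intro i j ω hi hj
    by_contra hij
    exact hi.1 (hj.2 i hij)
  let A : Fin n → Set Ω := fun i => {ω | if i = i₀ then ∀ j, j ≠ i₀ → ω ∉ B j else ω ∈ B i}
  have hA₀ : ∀ ω, ω ∈ A i₀ ↔ ∀ j, j ≠ i₀ → ω ∉ B j := fun ω => by simp [A]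
  have hA : ∀ i, i ≠ i₀ → ∀ ω, ω ∈ A i ↔ ω ∈ B i := fun i hi ω => by simp [A, hi]
  refine ⟨A, ⟨fun i => ?_, fun i j hij => ?_, ?_⟩, fun i => ?_⟩
  · by_cases hi : i = i₀
    · subst hi
      have : A i₀ = ⋂ j, ⋂ (_ : j ≠ i₀), (B j)ᶜ := by ext ω; simp [hA₀]
      rw [this]
      exact MeasurableSet.iInter fun j => MeasurableSet.iInter fun _ => (hB j).compl
    · rw [Set.ext (hA i hi)]
      exact hB i
  · ext ω
    simp only [mem_inter_iff, mem_empty_iff_false, iff_false, not_and]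
    clear_value A B i₀
    grind
  · refine eq_univ_of_forall fun ω => mem_iUnion.mpr ?_
    by_cases h : ∃ j, j ≠ i₀ ∧ ω ∈ B j
    · obtain ⟨j, hj, hω⟩ := h
      exact ⟨j, (hA j hj ω).mpr hω⟩
    · exact ⟨i₀, (hA₀ ω).mpr fun j hj hω => h ⟨j, hj, hω⟩⟩
  · filter_upwards [hsum, hm] with ω hω hmω
    have hsingle : (∀ j, j ≠ i → Xs j ω = m j) → Xs i ω = X ω - ∑ j, m j + m i := by
      intro h
      have : ∑ j, (Xs j ω - m j) = Xs i ω - m i :=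
        Finset.sum_eq_single i (fun j _ hj => by simp [h j hj]) (by simp)
      rw [Finset.sum_sub_distrib, hω] at this
      linarith
    have hmem : Xs i ω ≠ m i → ω ∈ B i := fun h =>
      ⟨h, fun j hj => (hmω j i hj).resolve_right h⟩
    by_cases hωA : ω ∈ A i
    · rw [indicator_of_mem hωA]
      refine hsingle fun j hj => ?_
      by_cases hi : i = i₀
      · subst hi
        by_contra hne
        exact (hA₀ ω).mp hωA j hj ⟨hne, fun l hl => (hmω l j hl).resolve_right hne⟩
      · exact ((hA i hi ω).mp hωA).2 j hj
    · rw [indicator_of_notMem hωA, zero_add]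
      by_contra hne
      by_cases hi : i = i₀
      · subst hi
        exact hωA ((hA₀ ω).mpr fun j hj hBj => hj (hBB j _ ω hBj (hmem hne)))
      · exact hωA ((hA i hi ω).mpr (hmem hne))

/-- Variables obtained by splitting a random variable of constant sign along a composition are
pairwise counter-monotonic. -/
theorem pairwiseCtr_of_composition {P : Measure Ω} [SFinite P] {n : ℕ} {Y : Ω → ℝ}
    {Xs : Fin n → Ω → ℝ} {m : Fin n → ℝ} {A : Fin n → Set Ω} (hA : IsComposition A)
    (hXs : ∀ i, Xs i =ᵐ[P] fun ω => (A i).indicator Y ω + m i)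
    (hY : (∀ᵐ ω ∂P, 0 ≤ Y ω) ∨ ∀ᵐ ω ∂P, Y ω ≤ 0) : PairwiseCtr P Xs := by
  classical
  intro i j hij
  have hYY : ∀ᵐ p ∂(P.prod P), 0 ≤ Y p.1 * Y p.2 := by
    rcases hY with h | h
    · filter_upwards [Measure.quasiMeasurePreserving_fst.ae h,
        Measure.quasiMeasurePreserving_snd.ae h] with p h₁ h₂ using mul_nonneg h₁ h₂
    · filter_upwards [Measure.quasiMeasurePreserving_fst.ae h,
        Measure.quasiMeasurePreserving_snd.ae h] with p h₁ h₂
        using mul_nonneg_of_nonpos_of_nonpos h₁ h₂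
  have hdisj : ∀ ω, ω ∈ A i → ω ∉ A j := fun ω hi hj =>
    (hA.2.1 i j hij).subset (⟨hi, hj⟩ : ω ∈ A i ∩ A j)
  filter_upwards [hYY, Measure.quasiMeasurePreserving_fst.ae (hXs i),
    Measure.quasiMeasurePreserving_snd.ae (hXs i), Measure.quasiMeasurePreserving_fst.ae (hXs j),
    Measure.quasiMeasurePreserving_snd.ae (hXs j)] with p hp h₁ h₂ h₃ h₄
  rw [h₁, h₂, h₃, h₄]
  simp only [indicator_apply, add_sub_add_right_eq_sub]
  have hd₁ := hdisj p.1
  have hd₂ := hdisj p.2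
  split_ifs <;> first | (exfalso; tauto) | nlinarith

/-- stochastic representation of pairwise counter-monotonic allocations.
On an atomless probability space with `n ≥ 3`, a bounded allocation `(X_1,…,X_n)` of a bounded
random variable `X` having at least three non-degenerate components is pairwise
counter-monotonic iff `X_i = (X − m)·1_{A_i} + m_i` for constants `m_1,…,m_n` with
`m = Σ m_i` and an `n`-composition `(A_1,…,A_n)`, where `m ≤ ess-inf X` or `m ≥ ess-sup X`. -/
theorem counterMonotonic_characterization
    (P : Measure Ω) [IsProbabilityMeasure P] (hP : Atomless P)
    {n : ℕ} (hn : 3 ≤ n)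
    (X : Ω → ℝ) (hX : Measurable X) (hXbd : ∃ M : ℝ, ∀ ω, |X ω| ≤ M)
    (Xs : Fin n → Ω → ℝ) (hXs : ∀ i, Measurable (Xs i))
    (hXsbd : ∀ i, ∃ M : ℝ, ∀ ω, |Xs i ω| ≤ M)
    (hsum : ∀ᵐ ω ∂P, ∑ i, Xs i ω = X ω)
    (hnondeg : ∃ i j k : Fin n, i ≠ j ∧ i ≠ k ∧ j ≠ k ∧
      (¬ ∃ c : ℝ, Xs i =ᵐ[P] fun _ => c) ∧
      (¬ ∃ c : ℝ, Xs j =ᵐ[P] fun _ => c) ∧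
      (¬ ∃ c : ℝ, Xs k =ᵐ[P] fun _ => c)) :
    PairwiseCtr P Xs ↔
      ∃ (m : Fin n → ℝ) (A : Fin n → Set Ω), IsComposition A ∧
        (∀ i, Xs i =ᵐ[P] fun ω =>
          (A i).indicator (fun ω' => X ω' - ∑ j, m j) ω + m i) ∧
        ((∑ j, m j) ≤ essInf X P ∨ essSup X P ≤ ∑ j, m j) := by
  obtain ⟨M, hM⟩ := hXbd
  have hbelow : Filter.IsBoundedUnder (· ≥ ·) (ae P) X :=
    Filter.isBoundedUnder_of ⟨-M, fun ω => (abs_le.mp (hM ω)).1⟩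
  have habove : Filter.IsBoundedUnder (· ≤ ·) (ae P) X :=
    Filter.isBoundedUnder_of ⟨M, fun ω => (abs_le.mp (hM ω)).2⟩
  constructor
  · intro h
    obtain ⟨p, q, r, hpq, hpr, hqr, hp, hq, hr⟩ := hnondeg
    obtain ⟨m, hm, hsign⟩ := (h.counterMonotoneSet_support hXs).exists_corner hpq hpr hqr
      (exists_ne_mem_support_of_nondegenerate hXs hp)
      (exists_ne_mem_support_of_nondegenerate hXs hq)
      (exists_ne_mem_support_of_nondegenerate hXs hr)
    have hmem := ae_mem_support_map (P := P) hXs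
    obtain ⟨A, hA, hXA⟩ := exists_composition_of_ae_eq_or_eq (by omega) hXs hsum
      (hmem.mono fun ω hω => hm _ hω)
    refine ⟨m, A, hA, hXA, hsign.imp (fun hle => ?_) fun hle => ?_⟩
    · refine le_essInf_of_ae_le _ ?_ habove.isCoboundedUnder_ge
      filter_upwards [hmem, hsum] with ω hω hωsum
      exact hωsum ▸ Finset.sum_le_sum fun i _ => hle _ hω i
    · refine essSup_le_of_ae_le _ ?_ hbelow.isCoboundedUnder_le
      filter_upwards [hmem, hsum] with ω hω hωsum
      exact hωsum ▸ Finset.sum_le_sum fun i _ => hle _ hω i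
  · rintro ⟨m, A, hA, hXA, hsign⟩
    refine pairwiseCtr_of_composition hA hXA (hsign.imp (fun hle => ?_) fun hle => ?_)
    · filter_upwards [ae_essInf_le hbelow] with ω hω using sub_nonneg.mpr (hle.trans hω)
    · filter_upwards [ae_le_essSup habove] with ω hω using sub_nonpos.mpr (hω.trans hle)
end
end

section
/- Let h_1,…,h_n ∈ H and let h = min_{i} h_i be their pointwise minimum. If h is dually subadditive, then for every X ∈ L^∞: ⊟_{i=1}^n ρ_{h_i}(X) ≥ ⊞_{i=1}^n ρ_{h_i}(X) = ρ_h(X) ≥ □_{i=1}^n ρ_{h_i}(X). -/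
open MeasureTheory ProbabilityTheory Set

noncomputable section

variable {Ω : Type*} [MeasurableSpace Ω]

/-- The distortion risk measure `ρ_h(X) = ∫_0^∞ h(P(X ≥ x)) dx + ∫_{-∞}^0 (h(P(X ≥ x)) − 1) dx`. -/
def distortion (P : Measure Ω) (h : ℝ → ℝ) (X : Ω → ℝ) : ℝ :=
  (∫ x in Ioi (0:ℝ), h ((P {ω | x ≤ X ω}).toReal)) +
    ∫ x in Iio (0:ℝ), (h ((P {ω | x ≤ X ω}).toReal) - 1)

/-- Bounded (essentially bounded, taking the everywhere-bounded representative)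
measurable random variables. -/
def MemLinf (X : Ω → ℝ) : Prop :=
  Measurable X ∧ ∃ M : ℝ, ∀ ω, |X ω| ≤ M

/-- `Xs` is an allocation of `X` in `L^∞`. -/
def IsAlloc (P : Measure Ω) {n : ℕ} (X : Ω → ℝ) (Xs : Fin n → Ω → ℝ) : Prop :=
  (∀ i, MemLinf (Xs i)) ∧ (∀ᵐ ω ∂P, ∑ i, Xs i ω = X ω)

/-- The (unconstrained) inf-convolution `□_{i=1}^n ρ_{h_i}(X)`, valued in `EReal`. -/
def infConv (P : Measure Ω) {n : ℕ} (h : Fin n → ℝ → ℝ) (X : Ω → ℝ) : EReal :=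
  sInf {y : EReal | ∃ Xs : Fin n → Ω → ℝ, IsAlloc P X Xs ∧
    y = ((∑ i, distortion P (h i) (Xs i) : ℝ) : EReal)}

/-- The comonotonic inf-convolution `⊞_{i=1}^n ρ_{h_i}(X)`. -/
def comInfConv (P : Measure Ω) {n : ℕ} (h : Fin n → ℝ → ℝ) (X : Ω → ℝ) : EReal :=
  sInf {y : EReal | ∃ Xs : Fin n → Ω → ℝ, IsAlloc P X Xs ∧ PairwiseCom P Xs ∧
    y = ((∑ i, distortion P (h i) (Xs i) : ℝ) : EReal)}

/-- The counter-monotonic inf-convolution `⊟_{i=1}^n ρ_{h_i}(X)`. -/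
def ctrInfConv (P : Measure Ω) {n : ℕ} (h : Fin n → ℝ → ℝ) (X : Ω → ℝ) : EReal :=
  sInf {y : EReal | ∃ Xs : Fin n → Ω → ℝ, IsAlloc P X Xs ∧ PairwiseCtr P Xs ∧
    y = ((∑ i, distortion P (h i) (Xs i) : ℝ) : EReal)}

/-- `h` is dually subadditive: `h` is subadditive and its dual `h̃(t) = 1 − h(1−t)`
is superadditive (on `[0,1]`). -/
def DuallySubadditive (h : ℝ → ℝ) : Prop :=
  (∀ x y : ℝ, 0 ≤ x → 0 ≤ y → x + y ≤ 1 → h (x + y) ≤ h x + h y) ∧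
  (∀ x y : ℝ, 0 ≤ x → 0 ≤ y → x + y ≤ 1 →
    (1 - h (1 - x)) + (1 - h (1 - y)) ≤ 1 - h (1 - (x + y)))

/-- The survival function `t ↦ P(X ≥ t)`. -/
def survival (P : Measure Ω) (X : Ω → ℝ) (t : ℝ) : ℝ := P.real {ω | t ≤ X ω}

/-- The generalized inverse `s ↦ sup {t | s < φ t}` of a decreasing function. -/
def upperQuantile (φ : ℝ → ℝ) (s : ℝ) : ℝ := sSup {t | s < φ t}

theorem survival_mem (P : Measure Ω) [IsProbabilityMeasure P] (X : Ω → ℝ) (t : ℝ) :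
    survival P X t ∈ Icc (0 : ℝ) 1 :=
  ⟨measureReal_nonneg, measureReal_le_one⟩

theorem MemH.le_of_le {h : ℝ → ℝ} (hh : MemH h) {x y : ℝ} (hx : 0 ≤ x) (hxy : x ≤ y)
    (hy : y ≤ 1) : h x ≤ h y :=
  hh.1 ⟨hx, hxy.trans hy⟩ ⟨hx.trans hxy, hy⟩ hxy

theorem MemH.nonneg {h : ℝ → ℝ} (hh : MemH h) {x : ℝ} (hx : x ∈ Icc (0 : ℝ) 1) : 0 ≤ h x := by
  have := hh.le_of_le le_rfl hx.1 hx.2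
  rwa [hh.2.1] at this

theorem MemH.le_one {h : ℝ → ℝ} (hh : MemH h) {x : ℝ} (hx : x ∈ Icc (0 : ℝ) 1) : h x ≤ 1 := by
  have := hh.le_of_le hx.1 hx.2 le_rfl
  rwa [hh.2.2] at this

/-- `φ` is the decreasing profile of a distorted survival function concentrated on `[-M, M]`. -/
structure IsProfile (φ : ℝ → ℝ) (M : ℝ) : Prop where
  anti : Antitone φ
  nonneg : ∀ t, 0 ≤ φ t
  le_one : ∀ t, φ t ≤ 1
  eq_one : ∀ t, t ≤ -M → φ t = 1
  eq_zero : ∀ t, M < t → φ t = 0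

theorem survival_mono_ae (P : Measure Ω) [IsProbabilityMeasure P] {X Y : Ω → ℝ}
    (hXY : ∀ᵐ ω ∂P, X ω ≤ Y ω) (t : ℝ) : survival P X t ≤ survival P Y t := by
  refine ENNReal.toReal_mono (measure_ne_top _ _) (measure_mono_ae ?_)
  filter_upwards [hXY] with ω hω h
  exact le_trans (show t ≤ X ω from h) hω

theorem survival_antitone (P : Measure Ω) [IsProbabilityMeasure P] (X : Ω → ℝ) :
    Antitone (survival P X) := fun _ _ hst =>
  measureReal_mono (fun _ hω => le_trans hst hω)

theorem isProfile_survival (P : Measure Ω) [IsProbabilityMeasure P] {h : ℝ → ℝ} (hh : MemH h)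
    {X : Ω → ℝ} {M : ℝ} (hM : ∀ ω, |X ω| ≤ M) : IsProfile (fun t => h (survival P X t)) M where
  anti := fun s t hst => hh.le_of_le (survival_mem P X t).1 (survival_antitone P X hst)
    (survival_mem P X s).2
  nonneg := fun t => hh.nonneg (survival_mem P X t)
  le_one := fun t => hh.le_one (survival_mem P X t)
  eq_one := fun t ht => by
    have : {ω | t ≤ X ω} = univ := eq_univ_of_forall fun ω => ht.trans (abs_le.1 (hM ω)).1
    simp [survival, this, hh.2.2]
  eq_zero := fun t ht => by
    have : {ω | t ≤ X ω} = ∅ := eq_empty_of_forall_notMem fun ω hω =>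
      absurd (le_trans (show t ≤ X ω from hω) (abs_le.1 (hM ω)).2) (not_le.2 ht)
    simp [survival, this, hh.2.1]

theorem IsProfile.intervalIntegrable {φ : ℝ → ℝ} {M : ℝ} (hφ : IsProfile φ M) (a b : ℝ) :
    IntervalIntegrable φ volume a b :=
  hφ.anti.intervalIntegrable

theorem distortion_eq (P : Measure Ω) [IsProbabilityMeasure P] {h : ℝ → ℝ} (hh : MemH h)
    {X : Ω → ℝ} {M : ℝ} (hM0 : 0 ≤ M) (hM : ∀ ω, |X ω| ≤ M) :
    distortion P h X = (∫ t in (-M)..M, h (survival P X t)) - M := by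
  have hφ := isProfile_survival P hh hM
  set φ := fun t => h (survival P X t) with hφdef
  have h1 : ∫ x in Ioi (0:ℝ), φ x = ∫ x in (0:ℝ)..M, φ x := by
    rw [intervalIntegral.integral_of_le hM0]
    refine setIntegral_eq_of_subset_of_forall_sdiff_eq_zero measurableSet_Ioi
      (fun x hx => hx.1) fun x hx => hφ.eq_zero x ?_
    by_contra hc
    exact hx.2 ⟨hx.1, not_lt.1 hc⟩
  have h2 : ∫ x in Iio (0:ℝ), (φ x - 1) = ∫ x in (-M)..0, (φ x - 1) := by
    rw [intervalIntegral.integral_of_le (by linarith), integral_Ioc_eq_integral_Ioo]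
    refine setIntegral_eq_of_subset_of_forall_sdiff_eq_zero measurableSet_Iio
      (fun x hx => hx.2) fun x hx => sub_eq_zero.2 (hφ.eq_one x ?_)
    by_contra hc
    exact hx.2 ⟨not_le.1 hc, hx.1⟩
  have h3 : distortion P h X = (∫ x in Ioi (0:ℝ), φ x) + ∫ x in Iio (0:ℝ), (φ x - 1) := rfl
  rw [h3, h1, h2, intervalIntegral.integral_sub (hφ.intervalIntegrable _ _) (by simp),
    ← intervalIntegral.integral_add_adjacent_intervals (hφ.intervalIntegrable (-M) 0)
      (hφ.intervalIntegrable 0 M)]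
  simp
  ring

theorem IsProfile.le_upperQuantile {φ : ℝ → ℝ} {M : ℝ} (hφ : IsProfile φ M) {s t : ℝ}
    (hs : 0 ≤ s) (ht : s < φ t) : t ≤ upperQuantile φ s := by
  refine le_csSup ⟨M, fun u hu => ?_⟩ ht
  by_contra hc
  have : s < φ u := hu
  rw [hφ.eq_zero u (not_le.1 hc)] at this
  linarith

theorem IsProfile.upperQuantile_le {φ : ℝ → ℝ} {M : ℝ} (hφ : IsProfile φ M) {s y : ℝ}
    (hs : s < 1) (hy : ∀ t, s < φ t → t ≤ y) : upperQuantile φ s ≤ y :=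
  csSup_le ⟨-M, by simpa [hφ.eq_one (-M) le_rfl] using hs⟩ hy

theorem IsProfile.lt_of_lt_upperQuantile {φ : ℝ → ℝ} {M : ℝ} (hφ : IsProfile φ M) {s t : ℝ}
    (hs : s < 1) (ht : t < upperQuantile φ s) : s < φ t := by
  by_contra hc
  refine absurd (hφ.upperQuantile_le hs fun u hu => ?_) (not_le.2 ht)
  by_contra hut
  exact hc (hu.trans_le (hφ.anti (not_le.1 hut).le))

theorem IsProfile.le_of_upperQuantile_lt {φ : ℝ → ℝ} {M : ℝ} (hφ : IsProfile φ M) {s t : ℝ}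
    (hs : 0 ≤ s) (ht : upperQuantile φ s < t) : φ t ≤ s := by
  by_contra hc
  exact absurd (hφ.le_upperQuantile hs (not_le.1 hc)) (not_le.2 ht)

theorem IsProfile.upperQuantile_mem {φ : ℝ → ℝ} {M : ℝ} (hφ : IsProfile φ M) {s : ℝ}
    (hs : s ∈ Ioo (0 : ℝ) 1) : upperQuantile φ s ∈ Icc (-M) M := by
  refine ⟨hφ.le_upperQuantile hs.1.le ?_, hφ.upperQuantile_le hs.2 fun t ht => ?_⟩
  · rw [hφ.eq_one _ le_rfl]; exact hs.2
  · by_contra hc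
    rw [hφ.eq_zero t (not_le.1 hc)] at ht
    exact absurd ht (not_lt.2 hs.1.le)

/-- Slicing the weighted area under a profile horizontally instead of vertically. -/
theorem IsProfile.integral_upperQuantile {φ : ℝ → ℝ} {M : ℝ} (hφ : IsProfile φ M) (hM : 0 ≤ M)
    {w : ℝ → ℝ} (hw : Measurable w) (hw1 : ∀ t, |w t| ≤ 1) :
    IntegrableOn (fun s => ∫ t in (-M)..(upperQuantile φ s), w t) (Ioo 0 1) ∧
    ∫ s in Ioo (0:ℝ) 1, ∫ t in (-M)..(upperQuantile φ s), w t = ∫ t in (-M)..M, w t * φ t := by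
  set F : ℝ × ℝ → ℝ := fun p => {p : ℝ × ℝ | p.1 < φ p.2}.indicator (fun p => w p.2) p with hF
  have hmeas : MeasurableSet {p : ℝ × ℝ | p.1 < φ p.2} :=
    measurableSet_lt measurable_fst (hφ.anti.measurable.comp measurable_snd)
  have hFm : Measurable F := (hw.comp measurable_snd).indicator hmeas
  have hFi : Integrable F ((volume.restrict (Ioo (0:ℝ) 1)).prod
      (volume.restrict (Ioc (-M) M))) := by
    refine Integrable.of_bound hFm.aestronglyMeasurable 1 (ae_of_all _ fun p => ?_)
    rw [hF]
    dsimp only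
    refine (norm_indicator_le_norm_self _ _).trans ?_
    simpa using hw1 p.2
  have hslice : ∀ s ∈ Ioo (0:ℝ) 1, ∫ t in Ioc (-M) M, F (s, t) =
      ∫ t in (-M)..(upperQuantile φ s), w t := by
    intro s hs
    have hq := hφ.upperQuantile_mem hs
    rw [intervalIntegral.integral_of_le hq.1]
    have h1 : ∫ t in Ioc (-M) M, F (s, t) =
        ∫ t in Ioc (-M) M, (Iic (upperQuantile φ s)).indicator w t := by
      refine integral_congr_ae (ae_restrict_of_ae ?_)
      filter_upwards [compl_mem_ae_iff.2 (measure_singleton (upperQuantile φ s))] with t ht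
      rcases lt_or_gt_of_ne (show t ≠ upperQuantile φ s from ht) with h | h
      · have := hφ.lt_of_lt_upperQuantile hs.2 h
        simp [hF, indicator, this, h.le]
      · have := hφ.le_of_upperQuantile_lt hs.1.le h
        simp [hF, indicator, this.not_gt, h.not_ge]
    rw [h1, setIntegral_indicator measurableSet_Iic]
    congr 2
    ext t
    simp only [mem_inter_iff, mem_Ioc, mem_Iic]
    exact ⟨fun h => ⟨h.1.1, h.2⟩, fun h => ⟨⟨h.1, h.2.trans hq.2⟩, h.2⟩⟩
  refine ⟨(integrableOn_congr_fun hslice measurableSet_Ioo).1 hFi.integral_prod_left, ?_⟩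
  rw [← setIntegral_congr_fun measurableSet_Ioo hslice,
    integral_integral_swap (f := fun s t => F (s, t)) hFi,
    intervalIntegral.integral_of_le (by linarith)]
  refine integral_congr_ae (ae_of_all _ fun t => ?_)
  have h2 : ∀ s ∈ Ioo (0:ℝ) 1, F (s, t) = (Iio (φ t)).indicator (fun _ => w t) s := by
    intro s _
    by_cases hst : s < φ t <;> simp [hF, indicator, hst]
  dsimp only
  rw [setIntegral_congr_fun measurableSet_Ioo h2, setIntegral_indicator measurableSet_Iio,
    setIntegral_const]
  have h3 : Ioo (0:ℝ) 1 ∩ Iio (φ t) = Ioo 0 (φ t) := by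
    ext s
    simp only [mem_inter_iff, mem_Ioo, mem_Iio]
    exact ⟨fun h => ⟨h.1.1, h.2⟩, fun h => ⟨⟨h.1, h.2.trans_le (hφ.le_one t)⟩, h.2⟩⟩
  rw [h3]
  simp [hφ.nonneg t, mul_comm]

theorem distortion_eq_integral_upperQuantile (P : Measure Ω) [IsProbabilityMeasure P]
    {h : ℝ → ℝ} (hh : MemH h) {X : Ω → ℝ} (hX : MemLinf X) :
    IntegrableOn (upperQuantile fun t => h (survival P X t)) (Ioo 0 1) ∧
    distortion P h X = ∫ s in Ioo (0:ℝ) 1, upperQuantile (fun t => h (survival P X t)) s := by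
  obtain ⟨-, M', hM'⟩ := hX
  have hM0 : 0 ≤ max M' 0 := le_max_right _ _
  have hM : ∀ ω, |X ω| ≤ max M' 0 := fun ω => (hM' ω).trans (le_max_left _ _)
  set M := max M' 0
  have hφ := isProfile_survival P hh hM
  have hq := hφ.integral_upperQuantile hM0 (w := fun _ => 1) measurable_const (by simp)
  simp only [intervalIntegral.integral_const, smul_eq_mul, mul_one, one_mul] at hq
  have hi : IntegrableOn (upperQuantile fun t => h (survival P X t)) (Ioo 0 1) := by
    have := hq.1.sub (integrableOn_const (C := M) (s := Ioo (0:ℝ) 1) (μ := volume) (by simp))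
    refine this.congr (ae_of_all _ fun s => ?_)
    simp
  refine ⟨hi, ?_⟩
  rw [distortion_eq P hh hM0 hM, ← hq.2]
  simp only [sub_neg_eq_add]
  rw [integral_add hi (by simp)]
  simp

theorem MemLinf.add {X Y : Ω → ℝ} (hX : MemLinf X) (hY : MemLinf Y) :
    MemLinf (fun ω => X ω + Y ω) := by
  obtain ⟨hXm, M, hM⟩ := hX
  obtain ⟨hYm, N, hN⟩ := hY
  exact ⟨hXm.add hYm, M + N, fun ω => (abs_add_le _ _).trans (add_le_add (hM ω) (hN ω))⟩

theorem memLinf_const (c : ℝ) : MemLinf (fun _ : Ω => c) :=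
  ⟨measurable_const, |c|, fun _ => le_rfl⟩

theorem MemLinf.add_const {X : Ω → ℝ} (hX : MemLinf X) (c : ℝ) : MemLinf (fun ω => X ω + c) :=
  hX.add (memLinf_const c)

theorem memLinf_sum {ι : Type*} (s : Finset ι) {F : ι → Ω → ℝ} (hF : ∀ i ∈ s, MemLinf (F i)) :
    MemLinf (fun ω => ∑ i ∈ s, F i ω) := by
  classical
  induction s using Finset.induction_on with
  | empty => simpa using memLinf_const (Ω := Ω) 0
  | insert a s ha ih =>
    simp only [Finset.sum_insert ha]
    exact (hF a (Finset.mem_insert_self a s)).add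
      (ih fun i hi => hF i (Finset.mem_insert_of_mem hi))

theorem memLinf_indicator {U : Set Ω} (hU : MeasurableSet U) (c : ℝ) :
    MemLinf (U.indicator fun _ => c) :=
  ⟨measurable_const.indicator hU, |c|, fun ω => by
    simpa using norm_indicator_le_norm_self (s := U) (fun _ => c) ω⟩

theorem MemLinf.exists_common_bound {X Y : Ω → ℝ} (hX : MemLinf X) (hY : MemLinf Y) :
    ∃ M : ℝ, 0 ≤ M ∧ (∀ ω, |X ω| ≤ M) ∧ ∀ ω, |Y ω| ≤ M := by
  obtain ⟨-, M, hM⟩ := hX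
  obtain ⟨-, N, hN⟩ := hY
  exact ⟨max (max M N) 0, le_max_right _ _,
    fun ω => (hM ω).trans ((le_max_left _ _).trans (le_max_left _ _)),
    fun ω => (hN ω).trans ((le_max_right _ _).trans (le_max_left _ _))⟩

theorem distortion_congr_ae (P : Measure Ω) (h : ℝ → ℝ) {X Y : Ω → ℝ} (hXY : X =ᵐ[P] Y) :
    distortion P h X = distortion P h Y := by
  have : ∀ t, P {ω | t ≤ X ω} = P {ω | t ≤ Y ω} := fun t =>
    measure_congr (hXY.mono fun ω hω => by
      change (t ≤ X ω) = (t ≤ Y ω)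
      rw [hω])
  simp [distortion, this]

theorem distortion_mono (P : Measure Ω) [IsProbabilityMeasure P] {h : ℝ → ℝ} (hh : MemH h)
    {X Y : Ω → ℝ} (hX : MemLinf X) (hY : MemLinf Y) (hXY : ∀ ω, X ω ≤ Y ω) :
    distortion P h X ≤ distortion P h Y := by
  obtain ⟨M, hM0, hMX, hMY⟩ := hX.exists_common_bound hY
  rw [distortion_eq P hh hM0 hMX, distortion_eq P hh hM0 hMY]
  refine sub_le_sub_right (intervalIntegral.integral_mono_on (by linarith)
    ((isProfile_survival P hh hMX).intervalIntegrable _ _)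
    ((isProfile_survival P hh hMY).intervalIntegrable _ _) fun t _ => ?_) _
  exact hh.le_of_le (survival_mem P X t).1 (survival_mono_ae P (ae_of_all _ hXY) t)
    (survival_mem P Y t).2

theorem distortion_mono_left (P : Measure Ω) [IsProbabilityMeasure P] {g h : ℝ → ℝ}
    (hg : MemH g) (hh : MemH h) (hgh : ∀ x, g x ≤ h x) {X : Ω → ℝ} (hX : MemLinf X) :
    distortion P g X ≤ distortion P h X := by
  obtain ⟨M, hM0, hMX, -⟩ := hX.exists_common_bound hX
  rw [distortion_eq P hg hM0 hMX, distortion_eq P hh hM0 hMX]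
  exact sub_le_sub_right (intervalIntegral.integral_mono_on (by linarith)
    ((isProfile_survival P hg hMX).intervalIntegrable _ _)
    ((isProfile_survival P hh hMX).intervalIntegrable _ _) fun t _ => hgh _) _

/-- If no pair of points separates `A` and `B` in opposite directions, then `A` and `B` are
nested up to a null set. -/
theorem ae_nested_of_prod (P : Measure Ω) [IsProbabilityMeasure P] {A B : Set Ω}
    (hAB : ∀ᵐ p ∂(P.prod P), ¬ (p.1 ∈ A \ B ∧ p.2 ∈ B \ A)) : A ≤ᵐ[P] B ∨ B ≤ᵐ[P] A := by
  have h0 : (P.prod P) ((A \ B) ×ˢ (B \ A)) = 0 := by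
    rw [ae_iff] at hAB
    convert hAB using 2
    ext p
    simp [and_assoc]
  rw [Measure.prod_prod, mul_eq_zero] at h0
  exact h0.imp ae_le_set.2 ae_le_set.2

theorem Comonotone.ae_nested {P : Measure Ω} [IsProbabilityMeasure P] {X Y : Ω → ℝ}
    (hXY : Comonotone P X Y) (x y : ℝ) :
    {ω | x ≤ X ω} ≤ᵐ[P] {ω | y ≤ Y ω} ∨ {ω | y ≤ Y ω} ≤ᵐ[P] {ω | x ≤ X ω} := by
  refine ae_nested_of_prod P (hXY.mono fun p hp hc => ?_)
  obtain ⟨⟨h1, h2⟩, h3, h4⟩ := hc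
  simp only [mem_ofPred_eq, not_le] at h1 h2 h3 h4
  nlinarith [mul_pos (show 0 < X p.1 - X p.2 by linarith) (show 0 < Y p.2 - Y p.1 by linarith)]

theorem CounterMonotone.ae_nested {P : Measure Ω} [IsProbabilityMeasure P] {X Y : Ω → ℝ}
    (hXY : CounterMonotone P X Y) (x y : ℝ) :
    {ω | x ≤ X ω} ≤ᵐ[P] {ω | Y ω < y} ∨ {ω | Y ω < y} ≤ᵐ[P] {ω | x ≤ X ω} := by
  refine ae_nested_of_prod P (hXY.mono fun p hp hc => ?_)
  obtain ⟨⟨h1, h2⟩, h3, h4⟩ := hc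
  simp only [mem_ofPred_eq, not_le, not_lt] at h1 h2 h3 h4
  nlinarith [mul_pos (show 0 < X p.1 - X p.2 by linarith) (show 0 < Y p.1 - Y p.2 by linarith)]

theorem upperQuantile_add (P : Measure Ω) [IsProbabilityMeasure P] {h : ℝ → ℝ} (hh : MemH h)
    {X Y : Ω → ℝ} (hX : MemLinf X) (hY : MemLinf Y) (hXY : Comonotone P X Y) {s : ℝ}
    (hs : s ∈ Ioo (0 : ℝ) 1) :
    upperQuantile (fun t => h (survival P (fun ω => X ω + Y ω) t)) s =
      upperQuantile (fun t => h (survival P X t)) s +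
      upperQuantile (fun t => h (survival P Y t)) s := by
  have hZ := hX.add hY
  obtain ⟨-, M, hM⟩ := hX
  obtain ⟨-, N, hN⟩ := hY
  obtain ⟨-, L, hL⟩ := hZ
  have hφ := isProfile_survival P hh hM
  have hψ := isProfile_survival P hh hN
  have hχ := isProfile_survival P hh hL
  have hle : ∀ {A B : Set Ω}, A ≤ᵐ[P] B → h (P.real A) ≤ h (P.real B) := fun hAB =>
    hh.le_of_le measureReal_nonneg
      (ENNReal.toReal_mono (measure_ne_top _ _) (measure_mono_ae hAB)) measureReal_le_one
  apply le_antisymm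
  · refine le_of_forall_pos_le_add fun ε hε => hχ.upperQuantile_le hs.2 fun t ht => ?_
    by_contra hc
    set x := upperQuantile (fun t => h (survival P X t)) s + ε / 2 with hx
    set y := upperQuantile (fun t => h (survival P Y t)) s + ε / 2 with hy
    have h1 : h (survival P X x) ≤ s := hφ.le_of_upperQuantile_lt hs.1.le (by linarith)
    have h2 : h (survival P Y y) ≤ s := hψ.le_of_upperQuantile_lt hs.1.le (by linarith)
    have hsub : ∀ ω, t ≤ X ω + Y ω → x ≤ X ω ∨ y ≤ Y ω := by
      intro ω hω
      by_contra! hcc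
      linarith [hcc.1, hcc.2]
    rcases hXY.ae_nested x y with hn | hn
    · refine absurd (hle (A := {ω | t ≤ X ω + Y ω}) (B := {ω | y ≤ Y ω}) ?_)
        (not_le.2 (h2.trans_lt ht))
      filter_upwards [hn] with ω hω hω'
      exact (hsub ω hω').elim (fun h => hω h) id
    · refine absurd (hle (A := {ω | t ≤ X ω + Y ω}) (B := {ω | x ≤ X ω}) ?_)
        (not_le.2 (h1.trans_lt ht))
      filter_upwards [hn] with ω hω hω'
      exact (hsub ω hω').elim id (fun h => hω h)
  · refine le_of_forall_pos_le_add fun ε hε => ?_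
    set x := upperQuantile (fun t => h (survival P X t)) s - ε / 2 with hx
    set y := upperQuantile (fun t => h (survival P Y t)) s - ε / 2 with hy
    have h1 : s < h (survival P X x) := hφ.lt_of_lt_upperQuantile hs.2 (by linarith)
    have h2 : s < h (survival P Y y) := hψ.lt_of_lt_upperQuantile hs.2 (by linarith)
    suffices s < h (survival P (fun ω => X ω + Y ω) (x + y)) by
      linarith [hχ.le_upperQuantile hs.1.le this]
    rcases hXY.ae_nested x y with hn | hn
    · refine h1.trans_le (hle ?_)
      filter_upwards [hn] with ω hω hω'
      exact add_le_add hω' (hω hω')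
    · refine h2.trans_le (hle ?_)
      filter_upwards [hn] with ω hω hω'
      exact add_le_add (hω hω') hω'

theorem distortion_add (P : Measure Ω) [IsProbabilityMeasure P] {h : ℝ → ℝ} (hh : MemH h)
    {X Y : Ω → ℝ} (hX : MemLinf X) (hY : MemLinf Y) (hXY : Comonotone P X Y) :
    distortion P h (fun ω => X ω + Y ω) = distortion P h X + distortion P h Y := by
  obtain ⟨hiX, heX⟩ := distortion_eq_integral_upperQuantile P hh hX
  obtain ⟨hiY, heY⟩ := distortion_eq_integral_upperQuantile P hh hY
  rw [(distortion_eq_integral_upperQuantile P hh (hX.add hY)).2, heX, heY,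
    ← integral_add hiX hiY]
  exact setIntegral_congr_fun measurableSet_Ioo fun s hs => upperQuantile_add P hh hX hY hXY hs

theorem distortion_const (P : Measure Ω) [IsProbabilityMeasure P] {h : ℝ → ℝ} (hh : MemH h)
    (c : ℝ) : distortion P h (fun _ => c) = c := by
  rw [distortion_eq P hh (abs_nonneg c) (fun _ => le_rfl)]
  have hφ := isProfile_survival P hh (X := fun _ : Ω => c) (M := |c|) fun _ => le_rfl
  rw [← intervalIntegral.integral_add_adjacent_intervals (hφ.intervalIntegrable (-|c|) c)
      (hφ.intervalIntegrable c |c|)]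
  have h1 : ∫ t in (-|c|)..c, h (survival P (fun _ => c) t) = ∫ t in (-|c|)..c, (1 : ℝ) := by
    refine intervalIntegral.integral_congr_ae (ae_of_all _ fun t ht => ?_)
    rw [uIoc_of_le (neg_abs_le c)] at ht
    simp [survival, ht.2, hh.2.2]
  have h2 : ∫ t in c..|c|, h (survival P (fun _ => c) t) = ∫ t in c..|c|, (0 : ℝ) := by
    refine intervalIntegral.integral_congr_ae (ae_of_all _ fun t ht => ?_)
    rw [uIoc_of_le (le_abs_self c)] at ht
    simp [survival, ht.1.not_ge, hh.2.1]
  rw [h1, h2]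
  simp

theorem distortion_add_const (P : Measure Ω) [IsProbabilityMeasure P] {h : ℝ → ℝ} (hh : MemH h)
    {X : Ω → ℝ} (hX : MemLinf X) (c : ℝ) :
    distortion P h (fun ω => X ω + c) = distortion P h X + c := by
  rw [distortion_add P hh hX (memLinf_const c) (ae_of_all _ fun p => by simp),
    distortion_const P hh]

theorem distortion_sum (P : Measure Ω) [IsProbabilityMeasure P] {h : ℝ → ℝ} (hh : MemH h)
    {ι : Type*} (s : Finset ι) {F : ι → Ω → ℝ} (hF : ∀ i, MemLinf (F i))
    (hcom : ∀ i j, i ≠ j → Comonotone P (F i) (F j)) :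
    distortion P h (fun ω => ∑ i ∈ s, F i ω) = ∑ i ∈ s, distortion P h (F i) := by
  classical
  induction s using Finset.induction_on with
  | empty => simpa using distortion_const P hh 0
  | insert a s ha ih =>
    simp only [Finset.sum_insert ha]
    rw [distortion_add P hh (hF a) (memLinf_sum s fun i _ => hF i), ih]
    have : ∀ᵐ p ∂(P.prod P), ∀ i ∈ s, 0 ≤ (F a p.1 - F a p.2) * (F i p.1 - F i p.2) :=
      (Filter.eventually_all_finset s).2 fun i hi => hcom a i (by rintro rfl; exact ha hi)
    filter_upwards [this] with p hp
    rw [← Finset.sum_sub_distrib, Finset.mul_sum]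
    exact Finset.sum_nonneg hp

/-- Subadditivity of a dually subadditive distortion for variables with disjoint supports. -/
theorem distortion_add_le_of_mul_eq_zero (P : Measure Ω) [IsProbabilityMeasure P] {h : ℝ → ℝ}
    (hh : MemH h) (hd : DuallySubadditive h) {X Y : Ω → ℝ} (hX : MemLinf X) (hY : MemLinf Y)
    (hXY : ∀ᵐ ω ∂P, X ω = 0 ∨ Y ω = 0) :
    distortion P h (fun ω => X ω + Y ω) ≤ distortion P h X + distortion P h Y := by
  obtain ⟨M, hM0, hMX, hMY⟩ := hX.exists_common_bound hY
  have hMZ : ∀ ω, |X ω + Y ω| ≤ 2 * M := fun ω => by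
    linarith [abs_add_le (X ω) (Y ω), hMX ω, hMY ω]
  replace hMX : ∀ ω, |X ω| ≤ 2 * M := fun ω => by linarith [hMX ω]
  replace hMY : ∀ ω, |Y ω| ≤ 2 * M := fun ω => by linarith [hMY ω]
  have hM2 : 0 ≤ 2 * M := by linarith
  have h00 : ∀ ω : Ω, |(fun _ => (0:ℝ)) ω| ≤ 2 * M := fun ω => by simpa using hM0
  have hpt : ∀ t, h (survival P (fun ω => X ω + Y ω) t) + h (survival P (fun _ => (0:ℝ)) t) ≤
      h (survival P X t) + h (survival P Y t) := by
    intro t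
    have ha := survival_mem P X t
    have hb := survival_mem P Y t
    have hp := survival_mem P (fun ω => X ω + Y ω) t
    rcases lt_or_ge 0 t with ht | ht
    · have h0 : survival P (fun _ => (0:ℝ)) t = 0 := by simp [survival, ht.not_ge]
      rw [h0, hh.2.1, add_zero]
      have hle : survival P (fun ω => X ω + Y ω) t ≤ survival P X t + survival P Y t := by
        refine le_trans (ENNReal.toReal_mono (measure_ne_top _ _) (measure_mono_ae ?_))
          (measureReal_union_le _ _)
        filter_upwards [hXY] with ω hω h1
        have h1' : t ≤ X ω + Y ω := h1
        rcases hω with hω | hω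
        · right; simpa [hω] using h1'
        · left; simpa [hω] using h1'
      rcases le_total (survival P (fun ω => X ω + Y ω) t) (survival P X t) with hc | hc
      · linarith [hh.le_of_le hp.1 hc ha.2, hh.nonneg hb]
      · have := hd.1 (survival P X t) (survival P (fun ω => X ω + Y ω) t - survival P X t)
          ha.1 (by linarith) (by linarith [hp.2])
        rw [add_sub_cancel] at this
        linarith [hh.le_of_le (x := survival P (fun ω => X ω + Y ω) t - survival P X t)
          (y := survival P Y t) (by linarith) (by linarith) hb.2]
    · have h0 : survival P (fun _ => (0:ℝ)) t = 1 := by simp [survival, ht]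
      rw [h0, hh.2.2]
      have hcompl : ∀ Z : Ω → ℝ, Measurable Z → survival P Z t = 1 - P.real {ω | Z ω < t} := by
        intro Z hZ
        rw [← probReal_compl_eq_one_sub (measurableSet_lt hZ measurable_const)]
        unfold survival
        congr 1
        ext ω
        simp
      have hdisj : AEDisjoint P {ω | X ω < t} {ω | Y ω < t} := by
        refine measure_eq_zero_iff_ae_notMem.2 ?_
        filter_upwards [hXY] with ω hω hc
        have h1 : X ω < t := hc.1
        have h2 : Y ω < t := hc.2
        rcases hω with hω | hω <;> linarith
      have hle : P.real {ω | X ω < t} + P.real {ω | Y ω < t} ≤ P.real {ω | X ω + Y ω < t} := by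
        rw [← measureReal_union₀ (measurableSet_lt hY.1 measurable_const).nullMeasurableSet hdisj]
        refine ENNReal.toReal_mono (measure_ne_top _ _) (measure_mono_ae ?_)
        filter_upwards [hXY] with ω hω h1
        change X ω + Y ω < t
        rcases h1 with h1 | h1 <;> have h1' : _ < t := h1 <;> rcases hω with hω | hω <;> linarith
      rw [hcompl X hX.1] at ha ⊢
      rw [hcompl Y hY.1] at hb ⊢
      rw [hcompl _ (hX.add hY).1] at hp ⊢
      have := hd.2 (P.real {ω | X ω < t}) (P.real {ω | Y ω < t}) measureReal_nonneg
        measureReal_nonneg (by linarith [hp.1])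
      linarith [hh.le_of_le (x := 1 - P.real {ω | X ω + Y ω < t})
        (y := 1 - (P.real {ω | X ω < t} + P.real {ω | Y ω < t})) hp.1 (by linarith)
        (by linarith [measureReal_nonneg (μ := P) (s := {ω | X ω < t}),
          measureReal_nonneg (μ := P) (s := {ω | Y ω < t})])]
  have hZ := distortion_eq P hh hM2 hMZ
  have h0 := distortion_eq P hh hM2 h00
  rw [distortion_const P hh] at h0
  have hX' := distortion_eq P hh hM2 hMX
  have hY' := distortion_eq P hh hM2 hMY
  have iX := (isProfile_survival P hh hMX).intervalIntegrable (-(2 * M)) (2 * M)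
  have iY := (isProfile_survival P hh hMY).intervalIntegrable (-(2 * M)) (2 * M)
  have iZ := (isProfile_survival P hh hMZ).intervalIntegrable (-(2 * M)) (2 * M)
  have i0 := (isProfile_survival P hh h00).intervalIntegrable (-(2 * M)) (2 * M)
  have hint := intervalIntegral.integral_mono_on (by linarith) (iZ.add i0) (iX.add iY)
    fun t _ => hpt t
  rw [intervalIntegral.integral_add iZ i0, intervalIntegral.integral_add iX iY] at hint
  linarith

/-- A dually subadditive distortion is subadditive along a chain of indicators with
coefficients of arbitrary sign. -/
theorem distortion_sum_le_of_nested (P : Measure Ω) [IsProbabilityMeasure P] {h : ℝ → ℝ}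
    (hh : MemH h) (hd : DuallySubadditive h) {ι : Type*} (s : Finset ι) {U : ι → Set Ω}
    (hU : ∀ i, MeasurableSet (U i)) (hchain : ∀ i j, U i ≤ᵐ[P] U j ∨ U j ≤ᵐ[P] U i)
    (c : ι → ℝ) :
    distortion P h (fun ω => ∑ i ∈ s, (U i).indicator (fun _ => c i) ω) ≤
      ∑ i ∈ s, distortion P h ((U i).indicator fun _ => c i) := by
  classical
  induction s using Finset.induction_on_min_value (fun i => P (U i)) with
  | empty => simpa using (distortion_const P hh 0).le
  | insert a s ha hmin ih =>
    simp only [Finset.sum_insert ha]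
    have hsub : ∀ i ∈ s, U a ≤ᵐ[P] U i := by
      intro i hi
      rcases hchain a i with hc | hc
      · exact hc
      · exact (ae_eq_of_ae_subset_of_measure_ge hc (hmin i hi) (hU i).nullMeasurableSet
          (measure_ne_top _ _)).symm.le
    have hK : MemLinf (fun ω => ∑ i ∈ s, (U i).indicator (fun _ => c i) ω) :=
      memLinf_sum s fun i _ => memLinf_indicator (hU i) (c i)
    set C := ∑ i ∈ s, c i
    have hle := distortion_add_le_of_mul_eq_zero P hh hd (hK.add_const (-C))
      (memLinf_indicator (hU a) (c a)) (by
        filter_upwards [(Filter.eventually_all_finset s).2 hsub] with ω hω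
        by_cases hωa : ω ∈ U a
        · left
          rw [Finset.sum_congr rfl fun i hi => indicator_of_mem (hω i hi hωa) _]
          exact add_neg_cancel C
        · exact Or.inr (indicator_of_notMem hωa _))
    rw [distortion_add_const P hh hK] at hle
    have heq : (fun ω => (U a).indicator (fun _ => c a) ω +
        ∑ i ∈ s, (U i).indicator (fun _ => c i) ω) = fun ω =>
        (∑ i ∈ s, (U i).indicator (fun _ => c i) ω + -C + (U a).indicator (fun _ => c a) ω)
          + C := by
      funext ω
      ring
    rw [heq, distortion_add_const P hh ((hK.add_const _).add (memLinf_indicator (hU a) (c a)))]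
    linarith

/-- The rounding of `z ∈ [0, N]` down to an integer, as a sum of threshold indicators. -/
theorem sum_threshold_eq_floor {z : ℝ} {N : ℕ} (hz : 0 ≤ z) (hzN : z ≤ N) (δ : ℝ) :
    ∑ i ∈ Finset.range N, (if ((i : ℝ) + 1) ≤ z then δ else 0) = ⌊z⌋₊ * δ := by
  rw [← Finset.sum_filter, Finset.sum_const, nsmul_eq_mul]
  congr 2
  have : Finset.filter (fun i : ℕ => ((i : ℝ) + 1) ≤ z) (Finset.range N) =
      Finset.range ⌊z⌋₊ := by
    ext i
    have h1 : ((i : ℝ) + 1 ≤ z) ↔ i < ⌊z⌋₊ := by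
      rw [← Nat.cast_add_one, ← Nat.le_floor_iff hz, Nat.succ_le_iff]
    have h2 : ⌊z⌋₊ ≤ N := Nat.floor_le_of_le hzN
    simp only [Finset.mem_filter, Finset.mem_range, h1]
    omega
  rw [this, Finset.card_range]

/-- The set where a function `X` exceeds the `i`-th threshold of the grid of mesh `δ` on `[-M, M]`. -/
def gridSet {α : Type*} (M δ : ℝ) (X : α → ℝ) (i : ℕ) : Set α := {ω | δ * (i + 1) - M ≤ X ω}

theorem measurableSet_gridSet (M δ : ℝ) {X : Ω → ℝ} (hX : Measurable X) (i : ℕ) :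
    MeasurableSet (gridSet M δ X i) :=
  measurableSet_le measurable_const hX

/-- Rounding a bounded random variable down to a finite grid. -/
theorem grid_approx {α : Type*} {M δ : ℝ} (hδ : 0 < δ) {N : ℕ} (hN : 2 * M / δ ≤ N) {X : α → ℝ}
    (hX : ∀ ω, |X ω| ≤ M) (ω : α) :
    ∑ i ∈ Finset.range N, (gridSet M δ X i).indicator (fun _ => δ) ω - M ≤ X ω ∧
    X ω ≤ ∑ i ∈ Finset.range N, (gridSet M δ X i).indicator (fun _ => δ) ω - M + δ := by
  obtain ⟨h1, h2⟩ := abs_le.1 (hX ω)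
  set z := (X ω + M) / δ with hz
  have hz0 : 0 ≤ z := div_nonneg (by linarith) hδ.le
  have hzN : z ≤ N := le_trans (div_le_div_of_nonneg_right (by linarith) hδ.le) hN
  have hsum : ∑ i ∈ Finset.range N, (gridSet M δ X i).indicator (fun _ => δ) ω = ⌊z⌋₊ * δ := by
    rw [← sum_threshold_eq_floor hz0 hzN]
    refine Finset.sum_congr rfl fun i _ => ?_
    have : ω ∈ gridSet M δ X i ↔ (i : ℝ) + 1 ≤ z := by
      rw [hz, le_div_iff₀ hδ]
      change δ * (i + 1) - M ≤ X ω ↔ _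
      constructor <;> intro h <;> linarith
    simp [indicator, this]
  have hzδ : z * δ = X ω + M := div_mul_cancel₀ _ hδ.ne'
  rw [hsum]
  have h3 := mul_le_mul_of_nonneg_right (Nat.floor_le hz0) hδ.le
  have h4 := mul_le_mul_of_nonneg_right (Nat.lt_floor_add_one z).le hδ.le
  constructor <;> linarith

theorem distortion_gridSum (P : Measure Ω) [IsProbabilityMeasure P] {h : ℝ → ℝ} (hh : MemH h)
    (M : ℝ) {δ : ℝ} (hδ : 0 < δ) (N : ℕ) {X : Ω → ℝ} (hX : Measurable X) :
    distortion P h (fun ω => ∑ i ∈ Finset.range N, (gridSet M δ X i).indicator (fun _ => δ) ω) =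
      ∑ i ∈ Finset.range N, distortion P h ((gridSet M δ X i).indicator fun _ => δ) := by
  refine distortion_sum P hh _ (fun i => memLinf_indicator (measurableSet_gridSet M δ hX i) δ)
    fun i j _ => ae_of_all _ fun p => ?_
  have hmono : ∀ (i : ℕ) (ω ω' : Ω), X ω ≤ X ω' →
      (gridSet M δ X i).indicator (fun _ => δ) ω ≤ (gridSet M δ X i).indicator (fun _ => δ) ω' := by
    intro i ω ω' hle
    by_cases hω : ω ∈ gridSet M δ X i
    · have hω' : ω' ∈ gridSet M δ X i := le_trans (show _ ≤ X ω from hω) hle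
      simp [hω, hω']
    · rw [indicator_of_notMem hω]
      exact indicator_nonneg (fun _ _ => hδ.le) _
  rcases le_total (X p.1) (X p.2) with hle | hle
  · exact mul_nonneg_of_nonpos_of_nonpos (sub_nonpos.2 (hmono i _ _ hle))
      (sub_nonpos.2 (hmono j _ _ hle))
  · exact mul_nonneg (sub_nonneg.2 (hmono i _ _ hle)) (sub_nonneg.2 (hmono j _ _ hle))

theorem distortion_gridSum_add_le (P : Measure Ω) [IsProbabilityMeasure P] {h : ℝ → ℝ}
    (hh : MemH h) (hd : DuallySubadditive h) (M δ : ℝ) (N : ℕ) {X Y : Ω → ℝ}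
    (hX : Measurable X) (hY : Measurable Y) (hXY : CounterMonotone P X Y) :
    distortion P h (fun ω => ∑ i ∈ Finset.range N, (gridSet M δ X i).indicator (fun _ => δ) ω +
      ∑ i ∈ Finset.range N, (gridSet M δ Y i).indicator (fun _ => δ) ω) ≤
      ∑ i ∈ Finset.range N, distortion P h ((gridSet M δ X i).indicator fun _ => δ) +
      ∑ i ∈ Finset.range N, distortion P h ((gridSet M δ Y i).indicator fun _ => δ) := by
  have hcompl : ∀ i, (gridSet M δ Y i).indicator (fun _ => δ) =
      fun ω => (gridSet M δ Y i)ᶜ.indicator (fun _ => -δ) ω + δ := by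
    intro i
    funext ω
    by_cases hω : ω ∈ gridSet M δ Y i <;> simp [hω]
  have hYm : ∀ i, MeasurableSet (gridSet M δ Y i)ᶜ := fun i =>
    (measurableSet_gridSet M δ hY i).compl
  have hXm := measurableSet_gridSet M δ hX
  set U : ℕ ⊕ ℕ → Set Ω := Sum.elim (gridSet M δ X) fun i => (gridSet M δ Y i)ᶜ with hUdef
  have hU : ∀ i, MeasurableSet (U i) := by rintro (i | i); exacts [hXm i, hYm i]
  have hgrid : ∀ (Z : Ω → ℝ) {a b : ℝ}, a ≤ b → {ω | b ≤ Z ω} ⊆ {ω | a ≤ Z ω} :=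
    fun Z a b hab ω hω => le_trans hab hω
  have hchainZ : ∀ (Z : Ω → ℝ) (i j : ℕ),
      gridSet M δ Z i ⊆ gridSet M δ Z j ∨ gridSet M δ Z j ⊆ gridSet M δ Z i := fun Z i j =>
    (le_total (δ * (j + 1) - M) (δ * (i + 1) - M)).imp (hgrid Z) (hgrid Z)
  have hset : ∀ i, (gridSet M δ Y i)ᶜ = {ω | Y ω < δ * (i + 1) - M} := by
    intro i
    ext ω
    exact not_le (a := δ * (i + 1) - M) (b := Y ω)
  have hchain : ∀ i j, U i ≤ᵐ[P] U j ∨ U j ≤ᵐ[P] U i := by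
    rintro (i | i) (j | j)
    · exact (hchainZ X i j).imp LE.le.eventuallyLE LE.le.eventuallyLE
    · simp only [hUdef, Sum.elim_inl, Sum.elim_inr, hset]
      exact hXY.ae_nested _ _
    · simp only [hUdef, Sum.elim_inl, Sum.elim_inr, hset]
      exact (hXY.ae_nested _ _).symm
    · exact (hchainZ Y j i).imp (fun h => (compl_subset_compl.2 h).eventuallyLE)
        fun h => (compl_subset_compl.2 h).eventuallyLE
  have hle := distortion_sum_le_of_nested P hh hd
    ((Finset.range N).disjSum (Finset.range N)) hU hchain (Sum.elim (fun _ => δ) fun _ => -δ)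
  simp only [Finset.sum_disjSum, hUdef, Sum.elim_inl, Sum.elim_inr] at hle
  have hlin : MemLinf (fun ω => ∑ i ∈ Finset.range N, (gridSet M δ X i).indicator (fun _ => δ) ω +
      ∑ i ∈ Finset.range N, (gridSet M δ Y i)ᶜ.indicator (fun _ => -δ) ω) :=
    (memLinf_sum _ fun i _ => memLinf_indicator (hXm i) _).add
      (memLinf_sum _ fun i _ => memLinf_indicator (hYm i) _)
  simp only [hcompl, distortion_add_const P hh (memLinf_indicator (hYm _) (-δ)),
    Finset.sum_add_distrib, ← add_assoc]
  rw [distortion_add_const P hh hlin]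
  linarith

theorem distortion_add_le_of_counterMonotone (P : Measure Ω) [IsProbabilityMeasure P]
    {h : ℝ → ℝ} (hh : MemH h) (hd : DuallySubadditive h) {X Y : Ω → ℝ} (hX : MemLinf X)
    (hY : MemLinf Y) (hXY : CounterMonotone P X Y) :
    distortion P h (fun ω => X ω + Y ω) ≤ distortion P h X + distortion P h Y := by
  obtain ⟨M, -, hMX, hMY⟩ := hX.exists_common_bound hY
  refine le_of_forall_pos_le_add fun ε hε => ?_
  set δ := ε / 2 with hδdef
  have hδ : 0 < δ := by positivity
  obtain ⟨N, hN⟩ := exists_nat_ge (2 * M / δ)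
  set A : Ω → ℝ := fun ω => ∑ i ∈ Finset.range N, (gridSet M δ X i).indicator (fun _ => δ) ω
  set B : Ω → ℝ := fun ω => ∑ i ∈ Finset.range N, (gridSet M δ Y i).indicator (fun _ => δ) ω
  have hA : MemLinf A :=
    memLinf_sum _ fun i _ => memLinf_indicator (measurableSet_gridSet M δ hX.1 i) _
  have hB : MemLinf B :=
    memLinf_sum _ fun i _ => memLinf_indicator (measurableSet_gridSet M δ hY.1 i) _
  have hAX := grid_approx hδ hN hMX
  have hBY := grid_approx hδ hN hMY
  have h1 : distortion P h (fun ω => X ω + Y ω) ≤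
      distortion P h (fun ω => A ω + B ω + (2 * δ - 2 * M)) :=
    distortion_mono P hh (hX.add hY) ((hA.add hB).add_const _) fun ω => by
      linarith [(hAX ω).2, (hBY ω).2]
  have h2 : distortion P h (fun ω => A ω + -M) ≤ distortion P h X :=
    distortion_mono P hh (hA.add_const _) hX fun ω => (hAX ω).1
  have h3 : distortion P h (fun ω => B ω + -M) ≤ distortion P h Y :=
    distortion_mono P hh (hB.add_const _) hY fun ω => (hBY ω).1
  have h4 : distortion P h (fun ω => A ω + B ω) ≤ distortion P h A + distortion P h B := by
    rw [distortion_gridSum P hh M hδ N hX.1, distortion_gridSum P hh M hδ N hY.1]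
    exact distortion_gridSum_add_le P hh hd M δ N hX.1 hY.1 hXY
  rw [distortion_add_const P hh (hA.add hB)] at h1
  rw [distortion_add_const P hh hA] at h2
  rw [distortion_add_const P hh hB] at h3
  linarith

theorem distortion_sum_le_of_counterMonotone (P : Measure Ω) [IsProbabilityMeasure P]
    {h : ℝ → ℝ} (hh : MemH h) (hd : DuallySubadditive h) {ι : Type*} (s : Finset ι)
    {F : ι → Ω → ℝ} (hF : ∀ i, MemLinf (F i))
    (hctr : ∀ i j, i ≠ j → CounterMonotone P (F i) (F j)) :
    distortion P h (fun ω => ∑ i ∈ s, F i ω) ≤ ∑ i ∈ s, distortion P h (F i) := by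
  classical
  induction s using Finset.induction_on with
  | empty => simpa using (distortion_const P hh 0).le
  | insert a s ha ih =>
    simp only [Finset.sum_insert ha]
    refine (distortion_add_le_of_counterMonotone P hh hd (hF a)
      (memLinf_sum s fun i _ => hF i) ?_).trans (add_le_add_right ih _)
    have : ∀ᵐ p ∂(P.prod P), ∀ i ∈ s, (F a p.1 - F a p.2) * (F i p.1 - F i p.2) ≤ 0 :=
      (Filter.eventually_all_finset s).2 fun i hi => hctr a i (by rintro rfl; exact ha hi)
    filter_upwards [this] with p hp
    rw [← Finset.sum_sub_distrib, Finset.mul_sum]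
    exact Finset.sum_nonpos hp

theorem upperQuantile_comp (P : Measure Ω) [IsProbabilityMeasure P] {h : ℝ → ℝ} (hh : MemH h)
    {X : Ω → ℝ} {M N : ℝ} (hM : ∀ ω, |X ω| ≤ M) {g : ℝ → ℝ} (hg : Monotone g)
    (hgc : Continuous g) (hN : ∀ ω, |g (X ω)| ≤ N) {s : ℝ} (hs : s ∈ Ioo (0 : ℝ) 1) :
    upperQuantile (fun t => h (survival P (fun ω => g (X ω)) t)) s =
      g (upperQuantile (fun t => h (survival P X t)) s) := by
  have hφ := isProfile_survival P hh hM
  have hψ := isProfile_survival P hh hN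
  set q := upperQuantile (fun t => h (survival P X t)) s
  have hle : ∀ {A B : Set Ω}, A ⊆ B → h (P.real A) ≤ h (P.real B) := fun hAB =>
    hh.le_of_le measureReal_nonneg (measureReal_mono hAB) measureReal_le_one
  apply le_antisymm
  · refine hψ.upperQuantile_le hs.2 fun y hy => ?_
    refine ge_of_tendsto ((hgc.tendsto q).mono_left (nhdsWithin_le_nhds (s := Ioi q))) ?_
    filter_upwards [self_mem_nhdsWithin] with t ht
    by_contra hc
    have h1 : h (survival P X t) ≤ s := hφ.le_of_upperQuantile_lt hs.1.le ht
    refine absurd (hle (A := {ω | y ≤ g (X ω)}) (B := {ω | t ≤ X ω}) fun ω hω => ?_)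
      (not_le.2 (h1.trans_lt hy))
    by_contra hc'
    have h2 : X ω < t := not_le.1 hc'
    exact hc (le_trans hω (hg h2.le))
  · refine le_of_tendsto ((hgc.tendsto q).mono_left (nhdsWithin_le_nhds (s := Iio q))) ?_
    filter_upwards [self_mem_nhdsWithin] with t ht
    exact hψ.le_upperQuantile hs.1.le
      ((hφ.lt_of_lt_upperQuantile hs.2 ht).trans_le (hle fun ω hω => hg hω))

/-- The distortion of a layer `∫_{-M}^X w` of `X` with density `w`. -/
theorem distortion_layer (P : Measure Ω) [IsProbabilityMeasure P] {h : ℝ → ℝ} (hh : MemH h)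
    {X : Ω → ℝ} {M : ℝ} (hM0 : 0 ≤ M) (hM : ∀ ω, |X ω| ≤ M) (hX : Measurable X) {w : ℝ → ℝ}
    (hw : Measurable w) (hw0 : ∀ t, 0 ≤ w t) (hw1 : ∀ t, w t ≤ 1) :
    Monotone (fun x => ∫ t in (-M)..x, w t) ∧
    MemLinf (fun ω => ∫ t in (-M)..(X ω), w t) ∧
    distortion P h (fun ω => ∫ t in (-M)..(X ω), w t) =
      ∫ t in (-M)..M, w t * h (survival P X t) := by
  have habs : ∀ t, |w t| ≤ 1 := fun t => abs_le.2 ⟨by linarith [hw0 t], hw1 t⟩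
  have hint : ∀ a b, IntervalIntegrable w volume a b := fun a b =>
    (intervalIntegrable_const (c := (1:ℝ))).mono_fun hw.aestronglyMeasurable
      (ae_of_all _ fun t => by simpa using habs t)
  have hcont : Continuous fun x => ∫ t in (-M)..x, w t :=
    intervalIntegral.continuous_primitive hint _
  have hmono : Monotone fun x => ∫ t in (-M)..x, w t := by
    intro x y hxy
    have := intervalIntegral.integral_nonneg (μ := volume) hxy fun t _ => hw0 t
    have h2 := intervalIntegral.integral_add_adjacent_intervals (hint (-M) x) (hint x y)
    dsimp only
    linarith
  have hbdd : ∀ ω, |∫ t in (-M)..(X ω), w t| ≤ 2 * M := by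
    intro ω
    have h1 := intervalIntegral.norm_integral_le_of_norm_le_const
      (a := -M) (b := X ω) (C := 1) (f := w) fun t _ => habs t
    have h2 := abs_le.1 (hM ω)
    rw [abs_of_nonneg (by linarith : (0:ℝ) ≤ X ω - -M)] at h1
    rw [← Real.norm_eq_abs]
    linarith
  have hlin : MemLinf (fun ω => ∫ t in (-M)..(X ω), w t) :=
    ⟨hcont.measurable.comp hX, 2 * M, hbdd⟩
  refine ⟨hmono, hlin, ?_⟩
  rw [(distortion_eq_integral_upperQuantile P hh hlin).2,
    ← ((isProfile_survival P hh hM).integral_upperQuantile hM0 hw habs).2]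
  exact setIntegral_congr_fun measurableSet_Ioo fun s hs =>
    upperQuantile_comp P hh hM hmono hcont hbdd hs

theorem exists_argmin_weights {n : ℕ} (hn : 0 < n) {f : Fin n → ℝ → ℝ} {m : ℝ → ℝ}
    (hf : ∀ i, Measurable (f i)) (hm : ∀ t, m t = ⨅ i, f i t) :
    ∃ w : Fin n → ℝ → ℝ, (∀ i, Measurable (w i)) ∧ (∀ i t, 0 ≤ w i t) ∧ (∀ i t, w i t ≤ 1) ∧
      (∀ t, ∑ i, w i t = 1) ∧ ∀ i t, w i t * f i t = w i t * m t := by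
  classical
  have : Nonempty (Fin n) := ⟨⟨0, hn⟩⟩
  have hmm : Measurable m := by
    rw [show m = fun t => ⨅ i, f i t from funext hm]
    exact Measurable.iInf hf
  set e : Fin n → ℝ → ℝ := fun i => {t | f i t = m t}.indicator fun _ => 1 with he
  have hem : ∀ i, Measurable (e i) := fun i =>
    measurable_const.indicator (measurableSet_eq_fun (hf i) hmm)
  have he0 : ∀ i t, 0 ≤ e i t := fun i t => indicator_nonneg (fun _ _ => zero_le_one) t
  have hpos : ∀ t, 0 < ∑ i, e i t := by
    intro t
    obtain ⟨i, hi⟩ := exists_eq_ciInf_of_finite (f := fun i => f i t)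
    refine Finset.sum_pos' (fun j _ => he0 j t) ⟨i, Finset.mem_univ i, ?_⟩
    have : f i t = m t := by rw [hm]; exact hi
    simp [he, this]
  refine ⟨fun i t => e i t / ∑ j, e j t, fun i =>
    (hem i).div (Finset.measurable_sum _ fun j _ => hem j), fun i t =>
    div_nonneg (he0 i t) (hpos t).le, fun i t => ?_, fun t => ?_, fun i t => ?_⟩
  · rw [div_le_one (hpos t)]
    exact Finset.single_le_sum (fun j _ => he0 j t) (Finset.mem_univ i)
  · rw [← Finset.sum_div, div_self (hpos t).ne']
  · by_cases hi : f i t = m t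
    · rw [hi]
    · simp [he, hi]

theorem memH_iInf {n : ℕ} (hn : 0 < n) {h : Fin n → ℝ → ℝ} (hH : ∀ i, MemH (h i))
    {hmin : ℝ → ℝ} (hmin_def : ∀ x, hmin x = ⨅ i, h i x) : MemH hmin := by
  have : Nonempty (Fin n) := ⟨⟨0, hn⟩⟩
  refine ⟨fun x hx y hy hxy => ?_, ?_, ?_⟩
  · rw [hmin_def, hmin_def]
    exact ciInf_mono (Set.finite_range _).bddBelow fun i => (hH i).1 hx hy hxy
  · simp [hmin_def, (hH _).2.1]
  · simp [hmin_def, (hH _).2.2]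

/-- A comonotonic allocation attaining the distortion by the pointwise minimum. -/
theorem exists_comonotone_alloc (P : Measure Ω) [IsProbabilityMeasure P] {n : ℕ} (hn : 0 < n)
    {h : Fin n → ℝ → ℝ} (hH : ∀ i, MemH (h i)) {hmin : ℝ → ℝ}
    (hmin_def : ∀ x, hmin x = ⨅ i, h i x) {X : Ω → ℝ} (hX : MemLinf X) :
    ∃ Xs : Fin n → Ω → ℝ, IsAlloc P X Xs ∧ PairwiseCom P Xs ∧
      distortion P hmin X = ∑ i, distortion P (h i) (Xs i) := by
  obtain ⟨M, hM0, hM, -⟩ := hX.exists_common_bound hX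
  have hn0 : (n : ℝ) ≠ 0 := Nat.cast_ne_zero.2 hn.ne'
  have hprof := fun i => isProfile_survival P (hH i) hM
  have hminH := memH_iInf hn hH hmin_def
  obtain ⟨w, hwm, hw0, hw1, hwsum, hwmin⟩ := exists_argmin_weights hn
    (f := fun i t => h i (survival P X t)) (m := fun t => hmin (survival P X t))
    (fun i => (hprof i).anti.measurable) fun t => hmin_def _
  have hlay := fun i => distortion_layer P (hH i) hM0 hM hX.1 (hwm i) (hw0 i) (hw1 i)
  have habs : ∀ i t, |w i t| ≤ 1 := fun i t => abs_le.2 ⟨by linarith [hw0 i t], hw1 i t⟩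
  have hint : ∀ i a b, IntervalIntegrable (w i) volume a b := fun i a b =>
    (intervalIntegrable_const (c := (1:ℝ))).mono_fun (hwm i).aestronglyMeasurable
      (ae_of_all _ fun t => by simpa using habs i t)
  have hminp := isProfile_survival P hminH hM
  refine ⟨fun i ω => (∫ t in (-M)..(X ω), w i t) + -(M / n),
    ⟨fun i => (hlay i).2.1.add_const _, ae_of_all _ fun ω => ?_⟩, fun i j _ => ?_, ?_⟩
  · rw [Finset.sum_add_distrib, ← intervalIntegral.integral_finsetSum fun i _ => hint i _ _]
    simp only [hwsum, Finset.sum_const, Finset.card_univ, Fintype.card_fin, nsmul_eq_mul,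
      intervalIntegral.integral_const, smul_eq_mul]
    field_simp
    ring
  · refine ae_of_all _ fun p => ?_
    simp only [add_sub_add_right_eq_sub]
    rcases le_total (X p.1) (X p.2) with hle | hle
    · exact mul_nonneg_of_nonpos_of_nonpos (sub_nonpos.2 ((hlay i).1 hle))
        (sub_nonpos.2 ((hlay j).1 hle))
    · exact mul_nonneg (sub_nonneg.2 ((hlay i).1 hle)) (sub_nonneg.2 ((hlay j).1 hle))
  · have hsum : ∀ i, distortion P (h i) (fun ω => (∫ t in (-M)..(X ω), w i t) + -(M / n)) =
        (∫ t in (-M)..M, w i t * hmin (survival P X t)) + -(M / n) := fun i => by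
      rw [distortion_add_const P (hH i) (hlay i).2.1, (hlay i).2.2]
      simp only [hwmin]
    rw [Finset.sum_congr rfl fun i _ => hsum i, Finset.sum_add_distrib,
      ← intervalIntegral.integral_finsetSum fun i _ => ?_, distortion_eq P hminH hM0 hM]
    · simp only [← Finset.sum_mul, hwsum, one_mul, Finset.sum_const, Finset.card_univ,
        Fintype.card_fin, nsmul_eq_mul]
      field_simp
      ring
    · refine (hminp.intervalIntegrable _ _).mono_fun
        ((hwm i).mul hminp.anti.measurable).aestronglyMeasurable (ae_of_all _ fun t => ?_)
      simp only [Real.norm_eq_abs, abs_mul]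
      exact mul_le_of_le_one_left (abs_nonneg _) (habs i t)

/-- Theorem 1 (i). If the pointwise minimum `h = min_i h_i` of the distortion
functions is dually subadditive, then
`⊟ ρ_{h_i}(X) ≥ ⊞ ρ_{h_i}(X) = ρ_h(X) ≥ □ ρ_{h_i}(X)` for every `X ∈ L^∞`. -/
theorem thm1_i
    (P : Measure Ω) [IsProbabilityMeasure P] (hP : Atomless P)
    {n : ℕ} (hn : 0 < n)
    (h : Fin n → ℝ → ℝ) (hH : ∀ i, MemH (h i))
    (hmin : ℝ → ℝ) (hmin_def : ∀ x, hmin x = ⨅ i, h i x)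
    (hdual : DuallySubadditive hmin)
    (X : Ω → ℝ) (hX : MemLinf X) :
    comInfConv P h X ≤ ctrInfConv P h X ∧
    comInfConv P h X = ((distortion P hmin X : ℝ) : EReal) ∧
    infConv P h X ≤ ((distortion P hmin X : ℝ) : EReal) := by
  have hminH := memH_iInf hn hH hmin_def
  have hle : ∀ i x, hmin x ≤ h i x := fun i x => by
    rw [hmin_def]
    exact ciInf_le (Set.finite_range _).bddBelow i
  have hlower : ∀ Xs : Fin n → Ω → ℝ, (∀ i, MemLinf (Xs i)) →
      ∑ i, distortion P hmin (Xs i) ≤ ∑ i, distortion P (h i) (Xs i) := fun Xs hXs =>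
    Finset.sum_le_sum fun i _ => distortion_mono_left P hminH (hH i) (hle i) (hXs i)
  obtain ⟨Xs, halloc, hcom, heq⟩ := exists_comonotone_alloc P hn hH hmin_def hX
  have hcom_eq : comInfConv P h X = ((distortion P hmin X : ℝ) : EReal) := by
    refine le_antisymm (sInf_le ⟨Xs, halloc, hcom, by rw [heq]⟩) (le_sInf ?_)
    rintro y ⟨Ys, ⟨hYs, hsum⟩, hYcom, rfl⟩
    rw [EReal.coe_le_coe_iff, ← distortion_congr_ae P hmin hsum,
      distortion_sum P hminH Finset.univ hYs hYcom]
    exact hlower Ys hYs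
  refine ⟨?_, hcom_eq, sInf_le ⟨Xs, halloc, by rw [heq]⟩⟩
  rw [hcom_eq]
  refine le_sInf ?_
  rintro y ⟨Ys, ⟨hYs, hsum⟩, hYctr, rfl⟩
  rw [EReal.coe_le_coe_iff, ← distortion_congr_ae P hmin hsum]
  exact (distortion_sum_le_of_counterMonotone P hminH hdual Finset.univ hYs hYctr).trans
    (hlower Ys hYs)
end
end
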